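/- arXiv:2504.06510 — 2 statements merged into one kernel-verified Lean document; each statement's English description precedes it below -/
import Mathlib

section
/- Let A be a unital (not necessarily commutative) ring, let X ∈ A, and let D : A → A be the inner derivation D(L) = X*L − L*X, with D^0 = id and D^k the k-fold iterate of D. Let b ∈ A be invertible with inverse r = b⁻¹. Then for all integers ℓ ≥ 1 and M ≥ 0 one has D^ℓ(r^M) = − Σ_{k=0}^{ℓ−1} Σ_{m₁=1}^{M} binom(ℓ,k) · D^k(r^{m₁}) · D^{ℓ−k}(b) · r^{M+1−m₁} (the inner sum runs over all pairs (m₁,m₂) of positive integers with m₁ + m₂ = M + 1). -/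
/-- The general Leibniz rule for iterates of an additive map satisfying the product rule on a
not necessarily commutative ring. -/
theorem iterate_mul_eq_sum_antidiagonal {A : Type*} [Ring A] (d : A →+ A)
    (hd : ∀ x y, d (x * y) = d x * y + x * d y) (n : ℕ) (x y : A) :
    d^[n] (x * y) =
      ∑ p ∈ Finset.HasAntidiagonal.antidiagonal n, n.choose p.1 • (d^[p.1] x * d^[p.2] y) := by
  induction n with
  | zero => simp
  | succ n ih =>
    rw [Finset.sum_antidiagonal_choose_succ_nsmul (fun i j => d^[i] x * d^[j] y) n,
      Function.iterate_succ_apply', ih, map_sum, ← Finset.sum_add_distrib]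
    refine Finset.sum_congr rfl fun p hp => ?_
    rw [map_nsmul, hd, ← Function.iterate_succ_apply' d, ← Function.iterate_succ_apply' d,
      nsmul_add, add_comm, Nat.choose_symm_of_eq_add (Finset.HasAntidiagonal.mem_antidiagonal.mp hp).symm]

/-- Commutator expansion for powers of an inverse (Lemma A.1):
`D^ℓ(r^M) = - Σ_{k=0}^{ℓ-1} Σ_{m₁+m₂=M+1, m₁,m₂≥1} C(ℓ,k) D^k(r^{m₁}) D^{ℓ-k}(b) r^{m₂}`,
where `D L = X*L - L*X` and `r = b⁻¹`. -/
theorem iterated_commutator_inv_pow {A : Type*} [Ring A] (X b r : A)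
    (hbr : b * r = 1) (hrb : r * b = 1)
    (D : A → A) (hD : ∀ L, D L = X * L - L * X)
    (ℓ M : ℕ) (hℓ : 1 ≤ ℓ) :
    D^[ℓ] (r ^ M) =
      - ∑ k ∈ Finset.range ℓ, ∑ m₁ ∈ Finset.Icc 1 M,
          (ℓ.choose k : ℕ) • (D^[k] (r ^ m₁) * D^[ℓ - k] b * r ^ (M + 1 - m₁)) := by
  obtain ⟨d, rfl⟩ : ∃ d : A →+ A, D = d :=
    ⟨AddMonoidHom.mulLeft X - AddMonoidHom.mulRight X, funext fun L => by simp [hD]⟩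
  have hmul (x y : A) : d (x * y) = d x * y + x * d y := by
    simp only [hD]
    noncomm_ring
  have hone : d^[ℓ] 1 = 0 := by
    obtain ⟨n, rfl⟩ := Nat.exists_eq_add_of_le' hℓ
    rw [Function.iterate_succ_apply, hD, mul_one, one_mul, sub_self, iterate_map_zero]
  have hstep (N : ℕ) : d^[ℓ] (r ^ (N + 1)) = d^[ℓ] (r ^ N) * r -
      ∑ k ∈ Finset.range ℓ, ℓ.choose k • (d^[k] (r ^ (N + 1)) * d^[ℓ - k] b * r) := by
    have h := iterate_mul_eq_sum_antidiagonal d hmul ℓ (r ^ (N + 1)) b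
    rw [pow_succ, mul_assoc, hrb, mul_one, ← pow_succ,
      Finset.Nat.sum_antidiagonal_eq_sum_range_succ_mk, Finset.sum_range_succ] at h
    simp [h, add_mul, Finset.sum_mul, mul_assoc, hbr]
  rw [Finset.sum_comm]
  induction M with
  | zero => simp [hone]
  | succ M ih =>
    rw [hstep, ih, Finset.sum_Icc_succ_top (by omega), neg_add, neg_mul, ← sub_eq_add_neg,
      Finset.sum_mul, Nat.add_sub_cancel_left, pow_one]
    congr 2
    refine Finset.sum_congr rfl fun m hm => ?_
    rw [Nat.sub_add_comm (n := M + 1) (by have := (Finset.mem_Icc.mp hm).2; omega),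
      Finset.sum_mul]
    simp only [pow_succ, mul_assoc, smul_mul_assoc]
end

section
/- Let α > 0, c > 0 and let k be a nonnegative integer. Then the function I : (0,∞) → ℝ defined by I(t) = Σ_{j ∈ ℤ} (t^{1/α}·2^j)^k · exp(−c·t·2^{αj}) is continuous on (0,∞). -/
/-- A polynomially weighted exponential series along the positive dyadic scales converges. -/
theorem summable_two_pow_mul_exp_neg_nat {α d : ℝ} (hα : 0 < α) (hd : 0 < d) (k : ℕ) :
    Summable fun n : ℕ => ((2 : ℝ) ^ n) ^ k * Real.exp (-d * (2 : ℝ) ^ (α * (n : ℝ))) := by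
  obtain ⟨N, hN⟩ := exists_nat_ge (((k : ℝ) + 1) / α)
  have hN' : (k : ℝ) + 1 ≤ α * N := by
    rw [div_le_iff₀ hα] at hN
    linarith
  refine Summable.of_nonneg_of_le (fun n => by positivity) (fun n => ?_)
    (summable_geometric_two.mul_left ((N.factorial : ℝ) / d ^ N))
  have hx : 0 < d * (2 : ℝ) ^ (α * (n : ℝ)) := by positivity
  have hpow : d ^ N * ((2 : ℝ) ^ n) ^ (k + 1) ≤ (d * (2 : ℝ) ^ (α * (n : ℝ))) ^ N := by
    rw [mul_pow, ← Real.rpow_mul_natCast (by norm_num), ← pow_mul, ← Real.rpow_natCast 2]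
    gcongr
    · norm_num
    · push_cast
      nlinarith [mul_le_mul_of_nonneg_left hN' (Nat.cast_nonneg (α := ℝ) n)]
  have hexp := Real.pow_div_factorial_le_exp _ hx.le N
  have hfac : (0 : ℝ) < N.factorial := by positivity
  rw [div_le_iff₀ hfac] at hexp
  rw [neg_mul, Real.exp_neg, ← div_eq_mul_inv, div_le_iff₀ (Real.exp_pos _), one_div, inv_pow]
  have h2 : (0 : ℝ) < 2 ^ n := by positivity
  have hmul := hpow.trans hexp
  rw [pow_succ] at hmul
  have hrw : (N.factorial : ℝ) / d ^ N * ((2 : ℝ) ^ n)⁻¹ *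
      Real.exp (d * (2 : ℝ) ^ (α * (n : ℝ))) =
      Real.exp (d * (2 : ℝ) ^ (α * (n : ℝ))) * N.factorial / (d ^ N * 2 ^ n) := by
    field_simp
  rw [hrw, le_div_iff₀ (by positivity)]
  linarith

/-- The two-sided dyadic series with a positive power weight converges. -/
theorem summable_two_zpow_mul_exp_neg {α d : ℝ} (hα : 0 < α) (hd : 0 < d) {k : ℕ} (hk : k ≠ 0) :
    Summable fun j : ℤ => ((2 : ℝ) ^ j) ^ k * Real.exp (-d * (2 : ℝ) ^ (α * (j : ℝ))) := by
  refine Summable.of_nat_of_neg ?_ ?_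
  · simpa using summable_two_pow_mul_exp_neg_nat hα hd k
  · refine Summable.of_nonneg_of_le (fun n => by positivity) (fun n => ?_) summable_geometric_two
    have hle : ((2 : ℝ) ^ (-(n : ℤ))) ≤ 1 := by
      rw [zpow_neg, zpow_natCast]
      exact inv_le_one_of_one_le₀ (one_le_pow₀ (by norm_num))
    calc ((2 : ℝ) ^ (-(n : ℤ))) ^ k * Real.exp (-d * (2 : ℝ) ^ (α * ((-(n : ℤ) : ℤ) : ℝ)))
        ≤ (2 : ℝ) ^ (-(n : ℤ)) * 1 := by
          gcongr
          · exact pow_le_of_le_one (by positivity) hle hk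
          · rw [Real.exp_le_one_iff, neg_mul, neg_nonpos]
            positivity
      _ = (1 / 2) ^ n := by simp

/-- Without a power weight the terms tend to `1` at small scales, so the series diverges. -/
theorem not_summable_exp_neg_two_rpow {α : ℝ} (hα : 0 < α) (d : ℝ) :
    ¬ Summable fun j : ℤ => Real.exp (-d * (2 : ℝ) ^ (α * (j : ℝ))) := by
  intro h
  have h0 := (h.comp_injective
    (neg_injective.comp Nat.cast_injective : Function.Injective fun n : ℕ => -(n : ℤ)))
    |>.tendsto_atTop_zero
  have hbot : Filter.Tendsto (fun n : ℕ => α * ((-(n : ℤ) : ℤ) : ℝ)) Filter.atTop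
      Filter.atBot := by
    push_cast
    exact (Filter.tendsto_neg_atTop_atBot.comp tendsto_natCast_atTop_atTop).const_mul_atBot hα
  have h1 := (Real.continuous_exp.tendsto _).comp
    (((tendsto_rpow_atBot_of_base_gt_one 2 (by norm_num)).comp hbot).const_mul (-d))
  rw [mul_zero, Real.exp_zero] at h1
  exact zero_ne_one (tendsto_nhds_unique h0 h1)

/-- Continuity on `(0,∞)` of the dyadic series
`I(t) = Σ_{j∈ℤ} (t^{1/α} 2^j)^k exp(-c t 2^{αj})`. -/
theorem dyadic_series_continuousOn (α c : ℝ) (hα : 0 < α) (hc : 0 < c) (k : ℕ) :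
    ContinuousOn (fun t : ℝ => ∑' j : ℤ,
      (t ^ (1 / α) * (2 : ℝ) ^ j) ^ k * Real.exp (-c * t * (2 : ℝ) ^ (α * (j : ℝ))))
      (Set.Ioi (0 : ℝ)) := by
  rcases eq_or_ne k 0 with rfl | hk
  · have hzero (t : ℝ) : ∑' j : ℤ, Real.exp (-c * t * (2 : ℝ) ^ (α * (j : ℝ))) = 0 := by
      simpa only [neg_mul] using
        tsum_eq_zero_of_not_summable (not_summable_exp_neg_two_rpow hα (c * t))
    simp only [pow_zero, one_mul, hzero]
    exact continuousOn_const
  intro t₀ ht₀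
  have ht₀ : 0 < t₀ := ht₀
  have hsum := (summable_two_zpow_mul_exp_neg hα (d := c * (t₀ / 2)) (by positivity) hk).mul_left
    (((2 * t₀) ^ (1 / α)) ^ k)
  refine (ContinuousOn.continuousAt (s := Set.Ioo (t₀ / 2) (2 * t₀))
    (continuousOn_tsum (fun j => ?_) hsum fun j t ht => ?_)
    (Ioo_mem_nhds (by linarith) (by linarith))).continuousWithinAt
  · have hroot : Continuous fun t : ℝ => t ^ (1 / α) :=
      Real.continuous_rpow_const (by positivity)
    exact Continuous.continuousOn (by fun_prop)
  · have ht0 : 0 < t := lt_trans (by positivity) ht.1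
    rw [Real.norm_of_nonneg (by positivity), mul_pow, mul_assoc]
    gcongr
    · exact ht.2.le
    · nlinarith [mul_lt_mul_of_pos_left ht.1 hc]
end
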